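/- Let k ≥ 3 be an integer. Suppose there exist a positive integer d, a constant c > 0, a real number s > 1, and N such that for all integers n > N, r_k(n) ≤ c·n / ((∏_{i=1}^{d−1} ln^{(i)}(n))·(ln^{(d)}(n))^s). Then every set A of positive integers containing no k-term arithmetic progression is small, i.e., the sum of the reciprocals of its elements converges. -/

import Mathlib

/-- A set `S` of natural numbers contains a `k`-term arithmetic progression:
there are `a` and `d ≥ 1` with `a, a+d, …, a+(k-1)d` all in `S`. -/
def HasAP (k : ℕ) (S : Set ℕ) : Prop :=
  ∃ a d : ℕ, 1 ≤ d ∧ ∀ i < k, a + i * d ∈ S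

/-- `rk k n` is the maximum size of a `k`-AP-free subset of `{1, …, n}`. -/
noncomputable def rk (k n : ℕ) : ℕ :=
  sSup {m | ∃ A : Finset ℕ, A ⊆ Finset.Icc 1 n ∧ ¬ HasAP k ↑A ∧ A.card = m}

open Filter Finset

theorem card_le_rk {k n : ℕ} {B : Finset ℕ} (hB : B ⊆ Finset.Icc 1 n)
    (hAP : ¬ HasAP k (B : Set ℕ)) : B.card ≤ rk k n := by
  refine le_csSup ⟨n, ?_⟩ ⟨B, hB, hAP, rfl⟩
  rintro m ⟨C, hC, -, rfl⟩
  simpa using Finset.card_le_card hC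

theorem HasAP.mono {k : ℕ} {S T : Set ℕ} (hST : S ⊆ T) (h : HasAP k S) : HasAP k T := by
  obtain ⟨a, d, hd, h⟩ := h
  exact ⟨a, d, hd, fun i hi => hST (h i hi)⟩

theorem tendsto_iterate_log_atTop (i : ℕ) : Tendsto (Real.log^[i]) atTop atTop := by
  induction i with
  | zero => exact tendsto_id
  | succ i ih => rw [Function.iterate_succ']; exact Real.tendsto_log_atTop.comp ih

theorem eventually_iterate_log_pos (d : ℕ) :
    ∀ᶠ x : ℝ in atTop, ∀ i ≤ d, 0 < Real.log^[i] x := by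
  have h : ∀ᶠ x : ℝ in atTop, ∀ i ∈ Finset.Iic d, 0 < Real.log^[i] x :=
    (Finset.eventually_all _).2 fun i _ => (tendsto_iterate_log_atTop i).eventually_gt_atTop 0
  simpa using h

theorem iterate_log_le_iterate_log {x y : ℝ} (hxy : x ≤ y) (i : ℕ)
    (hx : ∀ j < i, 0 < Real.log^[j] x) : Real.log^[i] x ≤ Real.log^[i] y := by
  induction i with
  | zero => exact hxy
  | succ i ih =>
    rw [Function.iterate_succ_apply', Function.iterate_succ_apply']
    exact Real.log_le_log (hx i i.lt_succ_self) (ih fun j hj => hx j (hj.trans i.lt_succ_self))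

theorem hasDerivAt_iterate_log {x : ℝ} (i : ℕ) (hx : ∀ j < i, 0 < Real.log^[j] x) :
    HasDerivAt (Real.log^[i]) (∏ j ∈ range i, Real.log^[j] x)⁻¹ x := by
  induction i with
  | zero => simpa using hasDerivAt_id x
  | succ i ih =>
    rw [Function.iterate_succ', prod_range_succ, mul_inv_rev]
    exact (Real.hasDerivAt_log (hx i i.lt_succ_self).ne').comp x
      (ih fun j hj => hx j (hj.trans i.lt_succ_self))

theorem hasDerivAt_iterate_log_rpow {x : ℝ} (d : ℕ) (s : ℝ) (hx : ∀ j ≤ d, 0 < Real.log^[j] x) :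
    HasDerivAt (fun y => (Real.log^[d] y) ^ (1 - s))
      (-((s - 1) / ((∏ j ∈ range d, Real.log^[j] x) * (Real.log^[d] x) ^ s))) x := by
  have h := (hasDerivAt_iterate_log d fun j hj => hx j hj.le).rpow_const
    (p := 1 - s) (Or.inl (hx d le_rfl).ne')
  refine h.congr_deriv ?_
  rw [show 1 - s - 1 = -s by ring, Real.rpow_neg (hx d le_rfl).le, div_eq_mul_inv, mul_inv]
  ring

theorem prod_range_iterate_log {d : ℕ} (hd : 1 ≤ d) (x : ℝ) :
    ∏ j ∈ range d, Real.log^[j] x = x * ∏ i ∈ Finset.Icc 1 (d - 1), Real.log^[i] x := by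
  obtain ⟨e, rfl⟩ := Nat.exists_eq_add_of_le' hd
  rw [prod_range_succ', mul_comm, Nat.add_sub_cancel]
  congr 1
  rw [range_eq_Ico, Finset.prod_Ico_add' (fun i => Real.log^[i] x) 0 e 1]
  rfl

/-- Mean value estimate for the reciprocal of the product of iterated logarithms. -/
theorem mul_inv_prod_iterate_log_le {d : ℕ} {s a b : ℝ} (hs : 1 < s) (hab : a < b)
    (ha : ∀ j ≤ d, 0 < Real.log^[j] a) :
    (b - a) * ((s - 1) / ((∏ j ∈ range d, Real.log^[j] b) * (Real.log^[d] b) ^ s)) ≤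
      (Real.log^[d] a) ^ (1 - s) - (Real.log^[d] b) ^ (1 - s) := by
  have hmono : ∀ x y, a ≤ x → x ≤ y → ∀ j ≤ d, 0 < Real.log^[j] x ∧
      Real.log^[j] x ≤ Real.log^[j] y := by
    intro x y hax hxy j hj
    have hpos : ∀ j ≤ d, 0 < Real.log^[j] x := fun j hj => (ha j hj).trans_le
      (iterate_log_le_iterate_log hax j fun i hi => ha i (hi.le.trans hj))
    exact ⟨hpos j hj, iterate_log_le_iterate_log hxy j fun i hi => hpos i (hi.le.trans hj)⟩
  have hderiv : ∀ x, a ≤ x → _ := fun x hx =>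
    hasDerivAt_iterate_log_rpow d s fun j hj => (hmono x x hx le_rfl j hj).1
  obtain ⟨ξ, ⟨haξ, hξb⟩, hξ⟩ := exists_hasDerivAt_eq_slope _ _ hab
    (fun x hx => (hderiv x hx.1).continuousAt.continuousWithinAt)
    (fun x hx => hderiv x hx.1.le)
  have hba : 0 < b - a := sub_pos.2 hab
  rw [eq_div_iff hba.ne'] at hξ
  have hξpos : ∀ j ≤ d, 0 < Real.log^[j] ξ := fun j hj => (hmono ξ b haξ.le hξb.le j hj).1
  have hle : (s - 1) / ((∏ j ∈ range d, Real.log^[j] b) * (Real.log^[d] b) ^ s) ≤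
      (s - 1) / ((∏ j ∈ range d, Real.log^[j] ξ) * (Real.log^[d] ξ) ^ s) := by
    have hP : 0 < ∏ j ∈ range d, Real.log^[j] ξ :=
      prod_pos fun j hj => hξpos j (mem_range.1 hj).le
    have hPle : ∏ j ∈ range d, Real.log^[j] ξ ≤ ∏ j ∈ range d, Real.log^[j] b :=
      prod_le_prod (fun j hj => (hξpos j (mem_range.1 hj).le).le)
        fun j hj => (hmono ξ b haξ.le hξb.le j (mem_range.1 hj).le).2
    have hL := Real.rpow_pos_of_pos (hξpos d le_rfl) s
    have hLle := Real.rpow_le_rpow (hξpos d le_rfl).le (hmono ξ b haξ.le hξb.le d le_rfl).2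
      (zero_le_one.trans hs.le)
    exact div_le_div_of_nonneg_left (sub_pos.2 hs).le (mul_pos hP hL)
      (mul_le_mul hPle hLle hL.le (hP.le.trans hPle))
  nlinarith [mul_le_mul_of_nonneg_left hle hba.le]

theorem summable_of_eventually_le_sub {u F : ℕ → ℝ} (hu : ∀ n, 0 ≤ u n)
    (h : ∀ᶠ n in atTop, u n ≤ F n - F (n + 1)) (hF : ∀ᶠ n in atTop, 0 ≤ F n) : Summable u := by
  obtain ⟨J, hJ⟩ := eventually_atTop.1 (h.and hF)
  rw [← summable_nat_add_iff J]
  refine summable_of_sum_range_le (c := F J) (fun n => hu _) fun n => ?_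
  have htel : ∑ i ∈ range n, u (i + J) ≤ F J - F (n + J) := by
    induction n with
    | zero => simp
    | succ n ih =>
      rw [sum_range_succ]
      have := (hJ (n + J) (Nat.le_add_left _ _)).1
      rw [show n + 1 + J = n + J + 1 by ring]
      linarith
  linarith [(hJ (n + J) (Nat.le_add_left _ _)).2]

theorem summable_one_div_of_summable_rk {k : ℕ}
    (h : Summable fun j : ℕ => (rk k (2 ^ (j + 1)) : ℝ) / 2 ^ j) {A : Set ℕ}
    (hA : ¬ HasAP k A) :
    Summable (fun a : A => (1 : ℝ) / (a : ℕ)) := by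
  classical
  set f : ℕ → ℝ := A.indicator fun n => (1 : ℝ) / n with hf
  have hf0 : ∀ n, 0 ≤ f n := fun n => Set.indicator_nonneg (fun _ _ => by positivity) n
  refine (summable_subtype_iff_indicator (f := fun n : ℕ => (1 : ℝ) / n)).2 ?_
  have hblock : ∀ j : ℕ, ∑ n ∈ Finset.Ico (2 ^ j) (2 ^ (j + 1)), f n ≤
      (rk k (2 ^ (j + 1)) : ℝ) / 2 ^ j := by
    intro j
    set B := {n ∈ Finset.Ico (2 ^ j) (2 ^ (j + 1)) | n ∈ A} with hB
    have hcard : B.card ≤ rk k (2 ^ (j + 1)) := by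
      refine card_le_rk (fun n hn => ?_) fun hAP => hA (hAP.mono fun n hn => ?_)
      · simp only [hB, mem_filter, Finset.mem_Ico] at hn
        exact Finset.mem_Icc.2 ⟨Nat.one_le_two_pow.trans hn.1.1, hn.1.2.le⟩
      · exact (mem_filter.1 (mem_coe.1 hn)).2
    calc ∑ n ∈ Finset.Ico (2 ^ j) (2 ^ (j + 1)), f n = ∑ n ∈ B, (1 : ℝ) / n := by
          rw [hB, sum_filter]
          exact sum_congr rfl fun n _ => Set.indicator_apply _ _ _
      _ ≤ ∑ n ∈ B, (1 : ℝ) / 2 ^ j := by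
          refine sum_le_sum fun n hn => ?_
          have h2 : 2 ^ j ≤ n := (Finset.mem_Ico.1 (mem_filter.1 hn).1).1
          exact one_div_le_one_div_of_le (by positivity) (by exact_mod_cast h2)
      _ = (B.card : ℝ) / 2 ^ j := by rw [sum_const, nsmul_eq_mul, mul_one_div]
      _ ≤ _ := by gcongr
  have hdyadic : ∀ n : ℕ, ∑ m ∈ range (2 ^ n), f m ≤
      ∑ j ∈ range n, (rk k (2 ^ (j + 1)) : ℝ) / 2 ^ j := by
    intro n
    induction n with
    | zero => simp [hf, Set.indicator_apply]
    | succ n ih =>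
      rw [← sum_range_add_sum_Ico f (Nat.pow_le_pow_right two_pos n.le_succ), sum_range_succ]
      exact add_le_add ih (hblock n)
  refine summable_of_sum_range_le (c := ∑' j : ℕ, (rk k (2 ^ (j + 1)) : ℝ) / 2 ^ j) hf0
    fun n => ?_
  exact (sum_le_sum_of_subset_of_nonneg (range_mono n.lt_two_pow_self.le)
    fun m _ _ => hf0 m).trans ((hdyadic n).trans
      (h.sum_le_tsum _ fun j _ => by positivity))

theorem apFree_sets_small_of_upper_bound (k : ℕ) (hk : 3 ≤ k)
    (hyp : ∃ d : ℕ, 1 ≤ d ∧ ∃ c : ℝ, 0 < c ∧ ∃ s : ℝ, 1 < s ∧ ∃ N : ℕ, ∀ n : ℕ, N < n →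
      (rk k n : ℝ) ≤ c * (n : ℝ) /
        ((∏ i ∈ Finset.Icc 1 (d - 1), Real.log^[i] (n : ℝ)) *
          (Real.log^[d] (n : ℝ)) ^ s)) :
    ∀ A : Set ℕ, (∀ x ∈ A, 1 ≤ x) → ¬ HasAP k A →
      Summable (fun a : A => (1 : ℝ) / (a : ℕ)) := by
  intro A _ hA
  obtain ⟨d, hd, c, hc, s, hs, N, hN⟩ := hyp
  refine summable_one_div_of_summable_rk ?_ hA
  have hs1 : 0 < s - 1 := sub_pos.2 hs
  have hpow : Tendsto (fun j : ℕ => (2 : ℝ) ^ j) atTop atTop :=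
    tendsto_pow_atTop_atTop_of_one_lt one_lt_two
  have hpos := hpow.eventually (eventually_iterate_log_pos d)
  refine summable_of_eventually_le_sub
    (F := fun j => 4 * c / (s - 1) * (Real.log^[d] ((2 : ℝ) ^ j)) ^ (1 - s))
    (fun j => by positivity) ?_ ?_
  · filter_upwards [hpos, eventually_ge_atTop N] with j hj hjN
    have hmv := mul_inv_prod_iterate_log_le (b := (2 : ℝ) ^ (j + 1)) hs
      (pow_lt_pow_right₀ one_lt_two j.lt_succ_self) hj
    have hrk := hN (2 ^ (j + 1)) ((hjN.trans_lt j.lt_succ_self).trans Nat.lt_two_pow_self)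
    push_cast at hrk
    rw [prod_range_iterate_log hd] at hmv
    set D := (∏ i ∈ Finset.Icc 1 (d - 1), Real.log^[i] ((2 : ℝ) ^ (j + 1))) *
      (Real.log^[d] ((2 : ℝ) ^ (j + 1))) ^ s with hD
    have h2 : (0 : ℝ) < 2 ^ j := by positivity
    rw [mul_assoc, ← hD] at hmv
    calc (rk k (2 ^ (j + 1)) : ℝ) / 2 ^ j ≤ c * 2 ^ (j + 1) / D / 2 ^ j := by gcongr
      _ = 4 * c / (s - 1) * ((2 ^ (j + 1) - 2 ^ j) * ((s - 1) / (2 ^ (j + 1) * D))) := by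
          rw [pow_succ]
          by_cases hD0 : D = 0
          · simp [hD0]
          · field_simp
            ring
      _ ≤ _ := by
          rw [← mul_sub]
          exact mul_le_mul_of_nonneg_left hmv (by positivity)
  · filter_upwards [hpos] with j hj
    have := Real.rpow_nonneg (hj d le_rfl).le (1 - s)
    positivity
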